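/- (λvsub Observability of Normal Form Approximants) Let k ∈ ℕ∪{ω}. If a term t of the λvsub-calculus belongs to the grammar no_k of S_k-normal forms, then its meaningful approximant A(t) belongs to the grammar bno_k of partial S_k-normal forms without ⊥ at depth k. -/

import Mathlib

/-- `i`-fold composition of a relation: `nSteps R i a b` holds iff `a` goes to
`b` in exactly `i` `R`-steps. -/
def nSteps {α : Type} (R : α → α → Prop) : ℕ → α → α → Prop
  | 0, a, b => a = b
  | n + 1, a, b => ∃ c, R a c ∧ nSteps R n c b

/-- Terms of the λvsub-calculus (value substitution calculus):
`sub t x u` is the explicit substitution `t[x←u]`, binding `x` in `t`. -/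
inductive VTerm : Type
  | var : ℕ → VTerm
  | lam : ℕ → VTerm → VTerm
  | app : VTerm → VTerm → VTerm
  | sub : VTerm → ℕ → VTerm → VTerm

/-- Values `v ::= x | λx.t`. -/
def VTerm.isValue : VTerm → Prop
  | .var _ => True
  | .lam _ _ => True
  | .app _ _ => False
  | .sub _ _ _ => False

/-- Free variables. -/
def VTerm.fv : VTerm → Finset ℕ
  | .var x => {x}
  | .lam x t => VTerm.fv t \ {x}
  | .app t u => VTerm.fv t ∪ VTerm.fv u
  | .sub t x u => (VTerm.fv t \ {x}) ∪ VTerm.fv u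

/-- Meta-level substitution `t{x:=v}`. -/
def VTerm.subst : VTerm → ℕ → VTerm → VTerm
  | .var y, x, v => if y = x then v else .var y
  | .lam y t, x, v => if y = x then .lam y t else .lam y (VTerm.subst t x v)
  | .app t u, x, v => .app (VTerm.subst t x v) (VTerm.subst u x v)
  | .sub t y u, x, v =>
      if y = x then .sub t y (VTerm.subst u x v)
      else .sub (VTerm.subst t x v) y (VTerm.subst u x v)

/-- List contexts `L ::= ⟨⟩ | L[x←t]`. -/
inductive VLCtx : Type
  | hole : VLCtx
  | sub : VLCtx → ℕ → VTerm → VLCtx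

def VLCtx.plug : VLCtx → VTerm → VTerm
  | .hole, t => t
  | .sub L x u, t => VTerm.sub (VLCtx.plug L t) x u

def VLCtx.binders : VLCtx → Finset ℕ
  | .hole => ∅
  | .sub L x _ => insert x (VLCtx.binders L)

/-- Root rewrite rules (βv) and (sv); the side conditions say that no free
variable is captured by the list context `L`. -/
inductive VRoot : VTerm → VTerm → Prop
  | beta (L : VLCtx) (x : ℕ) (s t : VTerm)
      (hcap : ∀ y ∈ VLCtx.binders L, y ∉ VTerm.fv t) :
      VRoot (.app (VLCtx.plug L (.lam x s)) t) (VLCtx.plug L (.sub s x t))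
  | subv (L : VLCtx) (t : VTerm) (x : ℕ) (v : VTerm)
      (hv : VTerm.isValue v)
      (hcap : ∀ y ∈ VLCtx.binders L, y ∉ VTerm.fv t \ {x}) :
      VRoot (.sub t x (VLCtx.plug L v)) (VLCtx.plug L (VTerm.subst t x v))

/-- Stratified reduction `→_{v_k}` for `k ∈ ℕ∪{ω}`, where `ω` is `⊤ : ℕ∞`:
the closure of the root rules under stratified contexts `S_k`.  The `lam`
rule raises the level by one; since `⊤ + 1 = ⊤`, level `⊤` (i.e. `ω`, full
reduction) allows reduction anywhere, while level `0` (surface reduction)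
forbids reduction under abstractions. -/
inductive VStep : ℕ∞ → VTerm → VTerm → Prop
  | root (k : ℕ∞) {t u : VTerm} : VRoot t u → VStep k t u
  | appL {k : ℕ∞} {t t' : VTerm} (u : VTerm) :
      VStep k t t' → VStep k (.app t u) (.app t' u)
  | appR {k : ℕ∞} (t : VTerm) {u u' : VTerm} :
      VStep k u u' → VStep k (.app t u) (.app t u')
  | subL {k : ℕ∞} {t t' : VTerm} (x : ℕ) (u : VTerm) :
      VStep k t t' → VStep k (.sub t x u) (.sub t' x u)
  | subR {k : ℕ∞} (t : VTerm) (x : ℕ) {u u' : VTerm} :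
      VStep k u u' → VStep k (.sub t x u) (.sub t x u')
  | lam {k : ℕ∞} (x : ℕ) {t t' : VTerm} :
      VStep k t t' → VStep (k + 1) (.lam x t) (.lam x t')

/-- `S_k`-normal terms: no `→_{v_k}` step applies. -/
def VNormal (k : ℕ∞) (t : VTerm) : Prop := ∀ u, ¬ VStep k t u

/-- Testing contexts `T ::= ⟨⟩ | T u | (λx.T) u`. -/
inductive VTCtx : Type
  | hole : VTCtx
  | app : VTCtx → VTerm → VTCtx
  | lamApp : ℕ → VTCtx → VTerm → VTCtx

def VTCtx.plug : VTCtx → VTerm → VTerm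
  | .hole, t => t
  | .app T u, t => .app (VTCtx.plug T t) u
  | .lamApp x T u, t => .app (.lam x (VTCtx.plug T t)) u

/-- A term is meaningful if some testing context sends it to a value by
surface reduction; otherwise it is meaningless. -/
def VMeaningful (t : VTerm) : Prop :=
  ∃ (T : VTCtx) (v : VTerm), VTerm.isValue v ∧
    Relation.ReflTransGen (VStep 0) (VTCtx.plug T t) v

/-- Full (one-hole) contexts `C ::= ⟨⟩ | λx.C | C t | t C | C[x←t] | t[x←C]`. -/
inductive VFCtx : Type
  | hole : VFCtx
  | lam : ℕ → VFCtx → VFCtx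
  | appL : VFCtx → VTerm → VFCtx
  | appR : VTerm → VFCtx → VFCtx
  | subL : VFCtx → ℕ → VTerm → VFCtx
  | subR : VTerm → ℕ → VFCtx → VFCtx

def VFCtx.plug : VFCtx → VTerm → VTerm
  | .hole, t => t
  | .lam x C, t => .lam x (VFCtx.plug C t)
  | .appL C u, t => .app (VFCtx.plug C t) u
  | .appR u C, t => .app u (VFCtx.plug C t)
  | .subL C x u, t => .sub (VFCtx.plug C t) x u
  | .subR u x C, t => .sub u x (VFCtx.plug C t)

mutual
  /-- Grammar `vr_k`. -/
  inductive VVr : ℕ∞ → VTerm → Prop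
    | var (k : ℕ∞) (x : ℕ) : VVr k (.var x)
    | sub {k : ℕ∞} {t : VTerm} (x : ℕ) {u : VTerm} :
        VVr k t → VNe k u → VVr k (.sub t x u)
  /-- Grammar `ne_k` (neutral normal forms). -/
  inductive VNe : ℕ∞ → VTerm → Prop
    | appVr {k : ℕ∞} {t u : VTerm} : VVr k t → VNo k u → VNe k (.app t u)
    | appNe {k : ℕ∞} {t u : VTerm} : VNe k t → VNo k u → VNe k (.app t u)
    | sub {k : ℕ∞} {t : VTerm} (x : ℕ) {u : VTerm} :
        VNe k t → VNe k u → VNe k (.sub t x u)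
  /-- Grammar `no_k` of `S_k`-normal forms.  `lam0` is the level-`0` clause
  `λx.t` (arbitrary body); `lamS` covers the clauses `λx.no_i` at level
  `i+1` and `λx.no_ω` at level `ω` (since `⊤ + 1 = ⊤`). -/
  inductive VNo : ℕ∞ → VTerm → Prop
    | lam0 (x : ℕ) (t : VTerm) : VNo 0 (.lam x t)
    | lamS {k : ℕ∞} (x : ℕ) {t : VTerm} : VNo k t → VNo (k + 1) (.lam x t)
    | vr {k : ℕ∞} {t : VTerm} : VVr k t → VNo k t
    | ne {k : ℕ∞} {t : VTerm} : VNe k t → VNo k t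
    | sub {k : ℕ∞} {t : VTerm} (x : ℕ) {u : VTerm} :
        VNo k t → VNe k u → VNo k (.sub t x u)
end

/-- Partial terms: terms extended with the constant `⊥`. -/
inductive PVTerm : Type
  | bot : PVTerm
  | var : ℕ → PVTerm
  | lam : ℕ → PVTerm → PVTerm
  | app : PVTerm → PVTerm → PVTerm
  | sub : PVTerm → ℕ → PVTerm → PVTerm

/-- Partial values `V ::= x | λx.T`. -/
def PVTerm.isValue : PVTerm → Prop
  | .var _ => True
  | .lam _ _ => True
  | _ => False

def PVTerm.fv : PVTerm → Finset ℕ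
  | .bot => ∅
  | .var x => {x}
  | .lam x t => PVTerm.fv t \ {x}
  | .app t u => PVTerm.fv t ∪ PVTerm.fv u
  | .sub t x u => (PVTerm.fv t \ {x}) ∪ PVTerm.fv u

def PVTerm.subst : PVTerm → ℕ → PVTerm → PVTerm
  | .bot, _, _ => .bot
  | .var y, x, v => if y = x then v else .var y
  | .lam y t, x, v => if y = x then .lam y t else .lam y (PVTerm.subst t x v)
  | .app t u, x, v => .app (PVTerm.subst t x v) (PVTerm.subst u x v)
  | .sub t y u, x, v =>
      if y = x then .sub t y (PVTerm.subst u x v)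
      else .sub (PVTerm.subst t x v) y (PVTerm.subst u x v)

/-- Embedding of terms into partial terms. -/
def VTerm.toP : VTerm → PVTerm
  | .var x => .var x
  | .lam x t => .lam x (VTerm.toP t)
  | .app t u => .app (VTerm.toP t) (VTerm.toP u)
  | .sub t x u => .sub (VTerm.toP t) x (VTerm.toP u)

/-- Partial list contexts. -/
inductive PVLCtx : Type
  | hole : PVLCtx
  | sub : PVLCtx → ℕ → PVTerm → PVLCtx

def PVLCtx.plug : PVLCtx → PVTerm → PVTerm
  | .hole, t => t
  | .sub L x u, t => PVTerm.sub (PVLCtx.plug L t) x u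

def PVLCtx.binders : PVLCtx → Finset ℕ
  | .hole => ∅
  | .sub L x _ => insert x (PVLCtx.binders L)

/-- Root rewrite rules (βv) and (sv) on partial terms. -/
inductive PVRoot : PVTerm → PVTerm → Prop
  | beta (L : PVLCtx) (x : ℕ) (s t : PVTerm)
      (hcap : ∀ y ∈ PVLCtx.binders L, y ∉ PVTerm.fv t) :
      PVRoot (.app (PVLCtx.plug L (.lam x s)) t) (PVLCtx.plug L (.sub s x t))
  | subv (L : PVLCtx) (t : PVTerm) (x : ℕ) (v : PVTerm)
      (hv : PVTerm.isValue v)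
      (hcap : ∀ y ∈ PVLCtx.binders L, y ∉ PVTerm.fv t \ {x}) :
      PVRoot (.sub t x (PVLCtx.plug L v)) (PVLCtx.plug L (PVTerm.subst t x v))

/-- Partial stratified reduction `→_{v_k}` on partial terms. -/
inductive PVStep : ℕ∞ → PVTerm → PVTerm → Prop
  | root (k : ℕ∞) {t u : PVTerm} : PVRoot t u → PVStep k t u
  | appL {k : ℕ∞} {t t' : PVTerm} (u : PVTerm) :
      PVStep k t t' → PVStep k (.app t u) (.app t' u)
  | appR {k : ℕ∞} (t : PVTerm) {u u' : PVTerm} :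
      PVStep k u u' → PVStep k (.app t u) (.app t u')
  | subL {k : ℕ∞} {t t' : PVTerm} (x : ℕ) (u : PVTerm) :
      PVStep k t t' → PVStep k (.sub t x u) (.sub t' x u)
  | subR {k : ℕ∞} (t : PVTerm) (x : ℕ) {u u' : PVTerm} :
      PVStep k u u' → PVStep k (.sub t x u) (.sub t x u')
  | lam {k : ℕ∞} (x : ℕ) {t t' : PVTerm} :
      PVStep k t t' → PVStep (k + 1) (.lam x t) (.lam x t')

/-- Partial full (one-hole) contexts. -/
inductive PVFCtx : Type
  | hole : PVFCtx
  | lam : ℕ → PVFCtx → PVFCtx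
  | appL : PVFCtx → PVTerm → PVFCtx
  | appR : PVTerm → PVFCtx → PVFCtx
  | subL : PVFCtx → ℕ → PVTerm → PVFCtx
  | subR : PVTerm → ℕ → PVFCtx → PVFCtx

def PVFCtx.plug : PVFCtx → PVTerm → PVTerm
  | .hole, t => t
  | .lam x C, t => .lam x (PVFCtx.plug C t)
  | .appL C u, t => .app (PVFCtx.plug C t) u
  | .appR u C, t => .app u (PVFCtx.plug C t)
  | .subL C x u, t => .sub (PVFCtx.plug C t) x u
  | .subR u x C, t => .sub u x (PVFCtx.plug C t)

/-- Approximation order on partial terms: the closure of `⊥ ≤ T` under all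
partial full contexts, reflexivity and transitivity. -/
inductive PLe : PVTerm → PVTerm → Prop
  | bot (C : PVFCtx) (T : PVTerm) : PLe (PVFCtx.plug C .bot) (PVFCtx.plug C T)
  | refl (T : PVTerm) : PLe T T
  | trans {T U S : PVTerm} : PLe T U → PLe U S → PLe T S

open Classical in
-- The meaningful approximant `A(t)`: `⊥` if `t` is meaningless, and defined
-- structurally otherwise.
noncomputable def VApprox : VTerm → PVTerm
  | .var x => if VMeaningful (.var x) then .var x else .bot
  | .lam x t => if VMeaningful (.lam x t) then .lam x (VApprox t) else .bot
  | .app t u => if VMeaningful (.app t u) then .app (VApprox t) (VApprox u) else .bot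
  | .sub t x u => if VMeaningful (.sub t x u) then .sub (VApprox t) x (VApprox u) else .bot

mutual
  /-- Grammar `bvr_k` on partial terms. -/
  inductive PBvr : ℕ∞ → PVTerm → Prop
    | var (k : ℕ∞) (x : ℕ) : PBvr k (.var x)
    | sub {k : ℕ∞} {t : PVTerm} (x : ℕ) {u : PVTerm} :
        PBvr k t → PBne k u → PBvr k (.sub t x u)
  /-- Grammar `bne_k` on partial terms. -/
  inductive PBne : ℕ∞ → PVTerm → Prop
    | appVr {k : ℕ∞} {t u : PVTerm} : PBvr k t → PBno k u → PBne k (.app t u)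
    | appNe {k : ℕ∞} {t u : PVTerm} : PBne k t → PBno k u → PBne k (.app t u)
    | sub {k : ℕ∞} {t : PVTerm} (x : ℕ) {u : PVTerm} :
        PBne k t → PBne k u → PBne k (.sub t x u)
  /-- Grammar `bno_k` of partial `S_k`-normal forms without `⊥` at depth
  `k`.  `lam0` is the level-`0` clause `λx.T` (arbitrary partial body);
  `lamS` covers levels `i+1` and `ω` (since `⊤ + 1 = ⊤`). -/
  inductive PBno : ℕ∞ → PVTerm → Prop
    | lam0 (x : ℕ) (T : PVTerm) : PBno 0 (.lam x T)
    | lamS {k : ℕ∞} (x : ℕ) {t : PVTerm} : PBno k t → PBno (k + 1) (.lam x t)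
    | vr {k : ℕ∞} {t : PVTerm} : PBvr k t → PBno k t
    | ne {k : ℕ∞} {t : PVTerm} : PBne k t → PBno k t
    | sub {k : ℕ∞} {t : PVTerm} (x : ℕ) {u : PVTerm} :
        PBno k t → PBne k u → PBno k (.sub t x u)
end

/-- The self-applicable term `λx.λy.x x`. -/
def VTerm.dup : VTerm := .lam 0 (.lam 1 (.app (.var 0) (.var 0)))

/-- A closed value that absorbs every value it is applied to. -/
def VTerm.ogre : VTerm := .lam 1 (.app .dup .dup)

/-- Replace every free variable outside `B` by `VTerm.ogre`. -/
def VTerm.fill : Finset ℕ → VTerm → VTerm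
  | B, .var x => if x ∈ B then .var x else .ogre
  | B, .lam x t => .lam x (VTerm.fill (insert x B) t)
  | B, .app t u => .app (VTerm.fill B t) (VTerm.fill B u)
  | B, .sub t x u => .sub (VTerm.fill (insert x B) t) x (VTerm.fill B u)

/-- The testing context `(λx₁.…(λxₙ.⟨⟩) ogre…) ogre`. -/
def VTCtx.close : List ℕ → VTCtx
  | [] => .hole
  | x :: l => .lamApp x (VTCtx.close l) .ogre

theorem VTerm.subst_ogre (x : ℕ) (v : VTerm) : VTerm.subst .ogre x v = .ogre := by
  simp only [VTerm.ogre, VTerm.dup, VTerm.subst]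
  split_ifs <;> simp_all

theorem VTerm.subst_app_dup_dup (x : ℕ) (v : VTerm) :
    VTerm.subst (.app .dup .dup) x v = .app .dup .dup := by
  simp only [VTerm.dup, VTerm.subst]
  split_ifs <;> simp_all

theorem VTerm.fill_of_fv_subset (t : VTerm) :
    ∀ B : Finset ℕ, VTerm.fv t ⊆ B → VTerm.fill B t = t := by
  induction t with
  | var x => intro B h; simp_all [VTerm.fv, VTerm.fill]
  | lam x t ih =>
    intro B h
    simp only [VTerm.fv, Finset.sdiff_singleton_eq_erase, ← Finset.subset_insert_iff] at h
    simp [VTerm.fill, ih _ h]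
  | app t u iht ihu =>
    intro B h
    simp only [VTerm.fv, Finset.union_subset_iff] at h
    simp [VTerm.fill, iht _ h.1, ihu _ h.2]
  | sub t x u iht ihu =>
    intro B h
    simp only [VTerm.fv, Finset.union_subset_iff, Finset.sdiff_singleton_eq_erase,
      ← Finset.subset_insert_iff] at h
    simp [VTerm.fill, iht _ h.1, ihu _ h.2]

theorem VTerm.subst_fill (t : VTerm) (x : ℕ) :
    ∀ B : Finset ℕ, x ∈ B →
      VTerm.subst (VTerm.fill B t) x .ogre = VTerm.fill (B.erase x) t := by
  induction t with
  | var y =>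
    intro B h
    by_cases hy : y ∈ B <;> by_cases hyx : y = x <;>
      simp_all [VTerm.fill, VTerm.subst, VTerm.subst_ogre]
  | lam y t ih =>
    intro B h
    by_cases hyx : y = x
    · subst hyx
      simp [VTerm.fill, VTerm.subst, h]
    · simp [VTerm.fill, VTerm.subst, hyx, ih _ (Finset.mem_insert_of_mem h),
        Finset.erase_insert_of_ne hyx]
  | app t u iht ihu => intro B h; simp [VTerm.fill, VTerm.subst, iht _ h, ihu _ h]
  | sub t y u iht ihu =>
    intro B h
    by_cases hyx : y = x
    · subst hyx
      simp [VTerm.fill, VTerm.subst, h, ihu _ h]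
    · simp [VTerm.fill, VTerm.subst, hyx, iht _ (Finset.mem_insert_of_mem h), ihu _ h,
        Finset.erase_insert_of_ne hyx]

/-- Reflexive-transitive closure of surface reduction. -/
abbrev VSteps : VTerm → VTerm → Prop := Relation.ReflTransGen (VStep 0)

theorem VSteps.appL {t t' : VTerm} (u : VTerm) (h : VSteps t t') :
    VSteps (.app t u) (.app t' u) :=
  h.lift (fun s => VTerm.app s u) fun _ _ => VStep.appL u

theorem VSteps.appR (t : VTerm) {u u' : VTerm} (h : VSteps u u') :
    VSteps (.app t u) (.app t u') :=
  h.lift (VTerm.app t) fun _ _ => VStep.appR t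

theorem VSteps.subR (t : VTerm) (x : ℕ) {u u' : VTerm} (h : VSteps u u') :
    VSteps (.sub t x u) (.sub t x u') :=
  h.lift (VTerm.sub t x) fun _ _ => VStep.subR t x

theorem VStep.beta_lam (x : ℕ) (s t : VTerm) :
    VStep 0 (.app (.lam x s) t) (.sub s x t) :=
  .root 0 (.beta .hole x s t (by simp [VLCtx.binders]))

theorem VStep.sub_value (t : VTerm) (x : ℕ) {v : VTerm} (hv : VTerm.isValue v) :
    VStep 0 (.sub t x v) (VTerm.subst t x v) :=
  .root 0 (.subv .hole t x v hv (by simp [VLCtx.binders]))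

theorem VSteps.beta_value (x : ℕ) (s : VTerm) {v : VTerm} (hv : VTerm.isValue v) :
    VSteps (.app (.lam x s) v) (VTerm.subst s x v) :=
  .head (.beta_lam x s v) (.single (.sub_value s x hv))

theorem VSteps.ogre_app {v : VTerm} (hv : VTerm.isValue v) :
    VSteps (.app .ogre v) .ogre := by
  have absorb := VSteps.beta_value 1 (.app .dup .dup) hv
  rw [VTerm.subst_app_dup_dup] at absorb
  exact absorb.trans (VSteps.beta_value (v := .dup) 0 (.lam 1 (.app (.var 0) (.var 0))) trivial)

theorem VSteps.app_ogre {t u v : VTerm} (ht : VSteps t .ogre) (hu : VSteps u v)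
    (hv : VTerm.isValue v) : VSteps (.app t u) .ogre :=
  ((ht.appL u).trans (hu.appR _)).trans (VSteps.ogre_app hv)

theorem VSteps.fill_sub (t : VTerm) (x : ℕ) {u : VTerm} (hu : VSteps (VTerm.fill ∅ u) .ogre) :
    VSteps (VTerm.fill ∅ (.sub t x u)) (VTerm.fill ∅ t) := by
  have fire := VStep.sub_value (VTerm.fill {x} t) x (v := .ogre) trivial
  rw [VTerm.subst_fill t x {x} (by simp), Finset.erase_singleton] at fire
  exact (hu.subR (VTerm.fill {x} t) x).trans (.single fire)

mutual

theorem VVr.steps_fill {k : ℕ∞} {t : VTerm} : VVr k t → VSteps (VTerm.fill ∅ t) .ogre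
  | .var _ x => by simpa [VTerm.fill] using Relation.ReflTransGen.refl
  | .sub x ht hu => (VSteps.fill_sub _ x hu.steps_fill).trans ht.steps_fill

theorem VNe.steps_fill {k : ℕ∞} {t : VTerm} : VNe k t → VSteps (VTerm.fill ∅ t) .ogre
  | .appVr ht hu =>
    let ⟨_, hv, hs⟩ := hu.steps_fill
    VSteps.app_ogre ht.steps_fill hs hv
  | .appNe ht hu =>
    let ⟨_, hv, hs⟩ := hu.steps_fill
    VSteps.app_ogre ht.steps_fill hs hv
  | .sub x ht hu => (VSteps.fill_sub _ x hu.steps_fill).trans ht.steps_fill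

theorem VNo.steps_fill {k : ℕ∞} {t : VTerm} :
    VNo k t → ∃ v, VTerm.isValue v ∧ VSteps (VTerm.fill ∅ t) v
  | .lam0 x t => ⟨VTerm.fill ∅ (.lam x t), trivial, .refl⟩
  | .lamS (t := t) x _ => ⟨VTerm.fill ∅ (.lam x t), trivial, .refl⟩
  | .vr h => ⟨.ogre, trivial, h.steps_fill⟩
  | .ne h => ⟨.ogre, trivial, h.steps_fill⟩
  | .sub x ht hu =>
    let ⟨v, hv, hs⟩ := ht.steps_fill
    ⟨v, hv, (VSteps.fill_sub _ x hu.steps_fill).trans hs⟩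

end

theorem VTCtx.subst_plug_close (x : ℕ) (t : VTerm) (l : List ℕ) (hx : x ∉ l) :
    VTerm.subst (VTCtx.plug (.close l) t) x .ogre =
      VTCtx.plug (.close l) (VTerm.subst t x .ogre) := by
  induction l with
  | nil => rfl
  | cons y l ih =>
    simp only [List.mem_cons, not_or] at hx
    simp [VTCtx.close, VTCtx.plug, VTerm.subst, VTerm.subst_ogre, Ne.symm hx.1, ih hx.2]

theorem VSteps.plug_close (t : VTerm) (l : List ℕ) (hl : l.Nodup) :
    VSteps (VTCtx.plug (.close l) (VTerm.fill l.toFinset t)) (VTerm.fill ∅ t) := by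
  induction l with
  | nil => exact .refl
  | cons x l ih =>
    rw [List.nodup_cons] at hl
    have fire := VSteps.beta_value x
      (VTCtx.plug (.close l) (VTerm.fill (x :: l).toFinset t)) (v := .ogre) trivial
    rw [VTCtx.subst_plug_close x _ l hl.1, VTerm.subst_fill t x _ (by simp),
      List.toFinset_cons, Finset.erase_insert (by simpa using hl.1)] at fire
    rw [List.toFinset_cons]
    exact fire.trans (ih hl.2)

theorem VNo.meaningful {k : ℕ∞} {t : VTerm} (h : VNo k t) : VMeaningful t := by
  obtain ⟨v, hv, hs⟩ := h.steps_fill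
  have close := VSteps.plug_close t (VTerm.fv t).toList (Finset.nodup_toList _)
  rw [Finset.toList_toFinset, VTerm.fill_of_fv_subset t _ subset_rfl] at close
  exact ⟨_, v, hv, close.trans hs⟩

theorem VApprox.app {t u : VTerm} (h : VMeaningful (.app t u)) :
    VApprox (.app t u) = .app (VApprox t) (VApprox u) := by
  rw [VApprox, if_pos h]

theorem VApprox.sub {t u : VTerm} {x : ℕ} (h : VMeaningful (.sub t x u)) :
    VApprox (.sub t x u) = .sub (VApprox t) x (VApprox u) := by
  rw [VApprox, if_pos h]

theorem VApprox.lam {t : VTerm} {x : ℕ} (h : VMeaningful (.lam x t)) :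
    VApprox (.lam x t) = .lam x (VApprox t) := by
  rw [VApprox, if_pos h]

theorem VApprox.var (x : ℕ) : VApprox (.var x) = .var x := by
  rw [VApprox, if_pos (VNo.vr (.var 0 x)).meaningful]

mutual

theorem VVr.approx {k : ℕ∞} {t : VTerm} : VVr k t → PBvr k (VApprox t)
  | .var _ x => VApprox.var x ▸ .var k x
  | .sub x ht hu =>
    VApprox.sub (VNo.vr (.sub x ht hu)).meaningful ▸ .sub x ht.approx hu.approx

theorem VNe.approx {k : ℕ∞} {t : VTerm} : VNe k t → PBne k (VApprox t)
  | .appVr ht hu => VApprox.app (VNo.ne (.appVr ht hu)).meaningful ▸ .appVr ht.approx hu.approx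
  | .appNe ht hu => VApprox.app (VNo.ne (.appNe ht hu)).meaningful ▸ .appNe ht.approx hu.approx
  | .sub x ht hu =>
    VApprox.sub (VNo.ne (.sub x ht hu)).meaningful ▸ .sub x ht.approx hu.approx

theorem VNo.approx {k : ℕ∞} {t : VTerm} : VNo k t → PBno k (VApprox t)
  | .lam0 x t => VApprox.lam (VNo.lam0 x t).meaningful ▸ .lam0 x _
  | .lamS x ht => VApprox.lam (VNo.lamS x ht).meaningful ▸ .lamS x ht.approx
  | .vr h => .vr h.approx
  | .ne h => .ne h.approx
  | .sub x ht hu => VApprox.sub (VNo.sub x ht hu).meaningful ▸ .sub x ht.approx hu.approx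

end

/-- (λvsub Observability of Normal Form Approximants) If a
term `t` belongs to the grammar `no_k` of `S_k`-normal forms, then its
meaningful approximant `A(t)` belongs to the grammar `bno_k`. -/
theorem vsub_observability_normal_form_approximants (k : ℕ∞) (t : VTerm)
    (h : VNo k t) : PBno k (VApprox t) := by
  exact h.approx
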